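/- Let n ≥ 1, let B be the open unit ball in ℝⁿ with closure B̄ and boundary the unit sphere, and let f, g : ℝⁿ → ℝ be smooth functions that are strictly positive on B̄ and satisfy ∫_B f dx = ∫_B g dx. Then there exists a map φ : ℝⁿ → ℝⁿ that is smooth on B̄, maps B̄ bijectively onto B̄, satisfies φ(x) = x for every x with ‖x‖ = 1, has det Dφ(x) > 0 for all x ∈ B, and satisfies g(x) = f(φ(x)) · det Dφ(x) for all x ∈ B. -/

import Mathlib

open MeasureTheory Metric

/-- The Jacobian matrix of a map `φ : ℝⁿ → ℝⁿ` at `x`, i.e. the matrix of the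
Fréchet derivative `Dφ(x)` in the standard basis. -/
noncomputable def jacMatrix {n : ℕ} (φ : EuclideanSpace ℝ (Fin n) → EuclideanSpace ℝ (Fin n))
    (x : EuclideanSpace ℝ (Fin n)) : Matrix (Fin n) (Fin n) ℝ :=
  LinearMap.toMatrix (EuclideanSpace.basisFun (Fin n) ℝ).toBasis
    (EuclideanSpace.basisFun (Fin n) ℝ).toBasis (fderiv ℝ φ x)

theorem dm_hasFDerivAt_param {E G : Type} [NormedAddCommGroup E] [NormedSpace ℝ E]
    [FiniteDimensional ℝ E] [NormedAddCommGroup G] [NormedSpace ℝ G]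
    (F : E × ℝ → G) (hF : ContDiff ℝ 1 F) (x₀ : E) :
    HasFDerivAt (fun x => ∫ t in (0:ℝ)..1, F (x, t))
      (∫ t in (0:ℝ)..1, (fderiv ℝ F (x₀, t)).comp (ContinuousLinearMap.inl ℝ E ℝ)) x₀ := by
  have hc : Continuous fun p : E × ℝ =>
      (fderiv ℝ F p).comp (ContinuousLinearMap.inl ℝ E ℝ) :=
    (hF.continuous_fderiv one_ne_zero).clm_comp continuous_const
  have hK : IsCompact (closedBall x₀ 1 ×ˢ Set.Icc (0:ℝ) 1) :=
    (isCompact_closedBall x₀ 1).prod isCompact_Icc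
  obtain ⟨C, hC⟩ := hK.exists_bound_of_continuousOn hc.continuousOn
  refine (intervalIntegral.hasFDerivAt_integral_of_dominated_of_fderiv_le
    (F := fun x t => F (x, t)) (bound := fun _ => C)
    (F' := fun x t => (fderiv ℝ F (x, t)).comp (ContinuousLinearMap.inl ℝ E ℝ))
    (s := ball x₀ 1) (ball_mem_nhds x₀ one_pos) ?_ ?_ ?_ ?_ ?_ ?_)
  · refine Filter.Eventually.of_forall fun x => ?_
    exact (hF.continuous.comp (by fun_prop : Continuous fun t : ℝ => (x, t))).aestronglyMeasurable
  · exact (hF.continuous.comp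
      (by fun_prop : Continuous fun t : ℝ => (x₀, t))).intervalIntegrable _ _
  · exact (hc.comp (by fun_prop : Continuous fun t : ℝ => (x₀, t))).aestronglyMeasurable
  · refine Filter.Eventually.of_forall fun t ht x hx => ?_
    refine hC (x, t) ⟨ball_subset_closedBall hx, ?_⟩
    rw [Set.uIoc_of_le zero_le_one] at ht
    exact Set.Ioc_subset_Icc_self ht
  · exact intervalIntegrable_const
  · refine Filter.Eventually.of_forall fun t ht x hx => ?_
    have h1 : HasFDerivAt F (fderiv ℝ F (x, t)) (x, t) :=
      (hF.differentiable one_ne_zero _).hasFDerivAt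
    exact h1.comp x (hasFDerivAt_prodMk_left x t)

theorem dm_contDiff_param_nat {E : Type} [NormedAddCommGroup E] [NormedSpace ℝ E]
    [FiniteDimensional ℝ E] (n : ℕ) : ∀ (G : Type) [NormedAddCommGroup G] [NormedSpace ℝ G]
    (F : E × ℝ → G), ContDiff ℝ n F → ContDiff ℝ n (fun x => ∫ t in (0:ℝ)..1, F (x, t)) := by
  induction n with
  | zero =>
    intro G _ _ F hF
    have hc : Continuous F := hF.continuous
    refine contDiff_zero.2 ?_
    exact intervalIntegral.continuous_parametric_intervalIntegral_of_continuous'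
      (f := fun x t => F (x, t)) (by exact hc) 0 1
  | succ n ih =>
    intro G _ _ F hF
    have hF1 : ContDiff ℝ 1 F := hF.of_le (by norm_cast; omega)
    have hd := dm_hasFDerivAt_param F hF1
    have hF' := hF
    push_cast at hF' ⊢
    rw [contDiff_succ_iff_fderiv] at hF' ⊢
    refine ⟨fun x => (hd x).differentiableAt, by simp, ?_⟩
    have : (fderiv ℝ fun x => ∫ t in (0:ℝ)..1, F (x, t)) = fun x =>
        ∫ t in (0:ℝ)..1, (fderiv ℝ F (x, t)).comp (ContinuousLinearMap.inl ℝ E ℝ) :=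
      funext fun x => (hd x).fderiv
    rw [this]
    exact ih _ (fun p => (fderiv ℝ F p).comp (ContinuousLinearMap.inl ℝ E ℝ))
      (hF'.2.2.clm_comp contDiff_const)

theorem dm_contDiff_param {E G : Type} [NormedAddCommGroup E] [NormedSpace ℝ E]
    [FiniteDimensional ℝ E] [NormedAddCommGroup G] [NormedSpace ℝ G]
    (F : E × ℝ → G) (hF : ContDiff ℝ (⊤ : ℕ∞) F) :
    ContDiff ℝ (⊤ : ℕ∞) (fun x => ∫ t in (0:ℝ)..1, F (x, t)) :=
  contDiff_infty.2 fun n => dm_contDiff_param_nat n G F (hF.of_le (by exact_mod_cast le_top))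

/-- Smooth dependence of a primitive on the parameter and on the upper bound. -/
theorem dm_contDiff_primitive {E : Type} [NormedAddCommGroup E] [NormedSpace ℝ E]
    [FiniteDimensional ℝ E]
    (F : E × ℝ → ℝ) (hF : ContDiff ℝ (⊤ : ℕ∞) F) :
    ContDiff ℝ (⊤ : ℕ∞) (fun p : E × ℝ => ∫ t in (0:ℝ)..p.2, F (p.1, t)) := by
  have h1 : (fun p : E × ℝ => ∫ t in (0:ℝ)..p.2, F (p.1, t)) =
      fun p : E × ℝ => p.2 * ∫ t in (0:ℝ)..1, F (p.1, t * p.2) := by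
    funext p
    have := intervalIntegral.mul_integral_comp_mul_right (a := 0) (b := 1)
      (f := fun t => F (p.1, t)) p.2
    simpa using this.symm
  rw [h1]
  refine contDiff_snd.mul ?_
  refine dm_contDiff_param (E := E × ℝ) (fun q => F (q.1.1, q.2 * q.1.2)) ?_
  exact hF.comp (by fun_prop)

/-- General version: both bounds vary. -/
theorem dm_contDiff_primitive₂ {E : Type} [NormedAddCommGroup E] [NormedSpace ℝ E]
    [FiniteDimensional ℝ E]
    (F : E × ℝ → ℝ) (hF : ContDiff ℝ (⊤ : ℕ∞) F) (a b : E → ℝ)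
    (ha : ContDiff ℝ (⊤ : ℕ∞) a) (hb : ContDiff ℝ (⊤ : ℕ∞) b) :
    ContDiff ℝ (⊤ : ℕ∞) (fun x : E => ∫ t in (a x)..(b x), F (x, t)) := by
  have h := dm_contDiff_primitive F hF
  have h1 : (fun x : E => ∫ t in (a x)..(b x), F (x, t)) =
      fun x => (∫ t in (0:ℝ)..(b x), F (x, t)) - ∫ t in (0:ℝ)..(a x), F (x, t) := by
    funext x
    have hc : Continuous fun t => F (x, t) := hF.continuous.comp (by fun_prop)
    rw [intervalIntegral.integral_interval_sub_left] <;> exact hc.intervalIntegrable _ _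
  rw [h1]
  exact (h.comp (contDiff_id.prodMk hb)).sub (h.comp (contDiff_id.prodMk ha))

/-- Global implicit function lemma for scalar equations, monotone in the unknown. -/
theorem dm_implicit {E : Type} [NormedAddCommGroup E] [NormedSpace ℝ E]
    [FiniteDimensional ℝ E] (K : E × ℝ → ℝ) (hK : ContDiff ℝ (⊤ : ℕ∞) K)
    (k : E → ℝ → ℝ) (hk : ∀ x u, HasDerivAt (fun s => K (x, s)) (k x u) u)
    (hkpos : ∀ x u, 0 < k x u) (u : E → ℝ) (hu : ∀ x, K (x, u x) = 0) :
    ContDiff ℝ (⊤ : ℕ∞) u := by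
  have hmono : ∀ x, StrictMono (fun s => K (x, s)) := fun x =>
    strictMono_of_deriv_pos fun s => by rw [(hk x s).deriv]; exact hkpos x s
  rw [contDiff_iff_contDiffAt]
  intro x
  have h0 : ContDiffAt ℝ (⊤ : ℕ∞) K (x, u x) := hK.contDiffAt
  have hne : ((⊤ : ℕ∞) : WithTop ℕ∞) ≠ 0 := by simp
  have hinv : (fderiv ℝ K (x, u x) ∘L .inr ℝ E ℝ).IsInvertible := by
    have hd : HasFDerivAt K (fderiv ℝ K (x, u x)) (x, u x) :=
      (hK.differentiable hne _).hasFDerivAt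
    have h1 : HasFDerivAt (fun s => K (x, s)) (fderiv ℝ K (x, u x) ∘L .inr ℝ E ℝ) (u x) :=
      hd.comp (u x) (hasFDerivAt_prodMk_right x (u x))
    have h2 := h1.unique (hk x (u x)).hasFDerivAt
    rw [h2]
    refine ⟨ContinuousLinearEquiv.unitsEquivAut ℝ (Units.mk0 (k x (u x)) (hkpos _ _).ne'), ?_⟩
    ext
    simp
  have h3 := h0.contDiffAt_implicitFunction hne hinv
  have h4 := h0.eventually_apply_implicitFunction hne hinv
  refine h3.congr_of_eventuallyEq ?_
  filter_upwards [h4] with y hy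
  refine (hmono y).injective ?_
  rw [hu y, hy, hu x]

/-- The one-dimensional rearrangement along a direction `v`. -/
theorem dm_core {E : Type} [NormedAddCommGroup E] [NormedSpace ℝ E]
    [FiniteDimensional ℝ E] (v : E) (h X : E → ℝ) (hh : ContDiff ℝ (⊤ : ℕ∞) h)
    (hX : ContDiff ℝ (⊤ : ℕ∞) X) (c : ℝ) (hc : 0 < c) (hch : ∀ x, c ≤ h x) :
    ∃ u : E → ℝ, ContDiff ℝ (⊤ : ℕ∞) u ∧ (∀ x, X x = 0 → u x = 0) ∧
      ∀ x, h (x + u x • v) * (1 + fderiv ℝ u x v) = h x + fderiv ℝ X x v := by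
  have hne : ((⊤ : ℕ∞) : WithTop ℕ∞) ≠ 0 := by simp
  set K : E × ℝ → ℝ := fun p => (∫ t in (0:ℝ)..p.2, h (p.1 + t • v)) - X p.1 with hKdef
  have hK : ContDiff ℝ (⊤ : ℕ∞) K :=
    (dm_contDiff_primitive (fun p => h (p.1 + p.2 • v)) (hh.comp (by fun_prop))).sub
      (hX.comp contDiff_fst)
  have hline : ∀ x, Continuous fun t : ℝ => h (x + t • v) := fun x =>
    hh.continuous.comp (by fun_prop)
  have hprim : ∀ x s, HasDerivAt (fun s => ∫ t in (0:ℝ)..s, h (x + t • v)) (h (x + s • v)) s :=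
    fun x s => intervalIntegral.integral_hasDerivAt_right ((hline x).intervalIntegrable _ _)
      ((hline x).stronglyMeasurableAtFilter _ _) (hline x).continuousAt
  have hk : ∀ x s, HasDerivAt (fun s => K (x, s)) (h (x + s • v)) s := fun x s => by
    simp only [hKdef]
    exact (hprim x s).sub_const _
  have hmono : ∀ x, StrictMono (fun s => K (x, s)) := fun x =>
    strictMono_of_deriv_pos fun s => by
      rw [(hk x s).deriv]; exact hc.trans_le (hch _)
  have hex : ∀ x, ∃ s, K (x, s) = 0 := by
    intro x
    have hcont : Continuous fun s => K (x, s) := hK.continuous.comp (by fun_prop)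
    have hge : ∀ s, 0 ≤ s → c * s ≤ ∫ t in (0:ℝ)..s, h (x + t • v) := by
      intro s hs
      have := intervalIntegral.integral_mono_on hs (intervalIntegrable_const (μ := volume) (c := c))
        ((hline x).intervalIntegrable 0 s) (fun t _ => hch _)
      simpa [mul_comm] using this
    have hle : ∀ s, s ≤ 0 → (∫ t in (0:ℝ)..s, h (x + t • v)) ≤ c * s := by
      intro s hs
      have := intervalIntegral.integral_mono_on hs (intervalIntegrable_const (μ := volume) (c := c))
        ((hline x).intervalIntegrable s 0) (fun t _ => hch _)
      rw [intervalIntegral.integral_symm]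
      simp at this
      linarith
    set b := |X x| / c with hb
    have hb0 : 0 ≤ b := by positivity
    have hcb : c * b = |X x| := by rw [hb]; field_simp
    have h1 : K (x, -b) ≤ 0 := by
      have := hle (-b) (by linarith)
      simp only [hKdef]
      have := neg_abs_le (X x)
      nlinarith
    have h2 : 0 ≤ K (x, b) := by
      have := hge b hb0
      simp only [hKdef]
      have := le_abs_self (X x)
      nlinarith
    obtain ⟨s, -, hs⟩ := intermediate_value_Icc (by linarith : -b ≤ b) hcont.continuousOn ⟨h1, h2⟩
    exact ⟨s, hs⟩
  choose u hu using hex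
  have hus : ContDiff ℝ (⊤ : ℕ∞) u :=
    dm_implicit K hK (fun x s => h (x + s • v)) hk (fun x s => hc.trans_le (hch _)) u hu
  refine ⟨u, hus, ?_, ?_⟩
  · intro x hx
    refine (hmono x).injective ?_
    simp only [hu x]
    simp [hKdef, hx]
  · intro x
    -- along the line
    have hl : HasDerivAt (fun τ : ℝ => x + τ • v) v 0 := by
      simpa using ((hasDerivAt_id (0:ℝ)).smul_const v).const_add x
    have hl0 : x + (0:ℝ) • v = x := by simp
    have hud : HasDerivAt (fun τ : ℝ => u (x + τ • v)) (fderiv ℝ u x v) 0 := by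
      have : HasFDerivAt u (fderiv ℝ u x) (x + (0:ℝ) • v) := by
        rw [hl0]; exact (hus.differentiable hne x).hasFDerivAt
      exact this.comp_hasDerivAt 0 hl
    have hXd : HasDerivAt (fun τ : ℝ => X (x + τ • v)) (fderiv ℝ X x v) 0 := by
      have : HasFDerivAt X (fderiv ℝ X x) (x + (0:ℝ) • v) := by
        rw [hl0]; exact (hX.differentiable hne x).hasFDerivAt
      exact this.comp_hasDerivAt 0 hl
    have hid : ∀ τ : ℝ, (∫ t in (0:ℝ)..(τ + u (x + τ • v)), h (x + t • v)) -
        (∫ t in (0:ℝ)..τ, h (x + t • v)) = X (x + τ • v) := by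
      intro τ
      rw [intervalIntegral.integral_interval_sub_left ((hline x).intervalIntegrable _ _)
        ((hline x).intervalIntegrable _ _)]
      have h1 := hu (x + τ • v)
      simp only [hKdef] at h1
      have h2 : (∫ t in (0:ℝ)..(u (x + τ • v)), h (x + τ • v + t • v)) =
          ∫ t in (0:ℝ)..(u (x + τ • v)), (fun s => h (x + s • v)) (τ + t) := by
        congr 1; funext t; simp only; congr 1; module
      rw [h2, intervalIntegral.integral_comp_add_left (fun s => h (x + s • v)) τ] at h1
      simp only [add_zero] at h1
      linarith
    have hd1 : HasDerivAt (fun τ : ℝ => (∫ t in (0:ℝ)..(τ + u (x + τ • v)), h (x + t • v)))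
        (h (x + u x • v) * (1 + fderiv ℝ u x v)) 0 := by
      have h1 : HasDerivAt (fun τ : ℝ => τ + u (x + τ • v)) (1 + fderiv ℝ u x v) 0 :=
        (hasDerivAt_id (0:ℝ)).add hud
      have h2 := hprim x (0 + u (x + (0:ℝ) • v))
      have h3 := h2.comp (0:ℝ) h1
      have h4 : h (x + (0 + u (x + (0:ℝ) • v)) • v) = h (x + u x • v) := by simp
      rw [h4] at h3
      exact h3
    have hd2 := hprim x 0
    have hd := (hd1.sub hd2).congr_of_eventuallyEq
      (Filter.Eventually.of_forall fun τ => (hid τ).symm)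
    have := hd.unique hXd
    rw [hl0] at this
    linarith

/-- A smooth function bounded below on a set can be replaced by one which is bounded below. -/
theorem dm_cutoff {E : Type} [NormedAddCommGroup E] [NormedSpace ℝ E]
    (h : E → ℝ) (hh : ContDiff ℝ (⊤ : ℕ∞) h) (s : Set E) (c : ℝ) (hc : 0 < c)
    (hs : ∀ x ∈ s, c ≤ h x) :
    ∃ k : E → ℝ, ContDiff ℝ (⊤ : ℕ∞) k ∧ (∀ x, c / 2 ≤ k x) ∧ ∀ x ∈ s, k x = h x := by
  refine ⟨fun x => Real.smoothTransition ((h x - c / 2) / (c / 2)) * (h x - c / 2) + c / 2,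
    ?_, ?_, ?_⟩
  · have h1 : ContDiff ℝ (⊤ : ℕ∞) fun x => (h x - c / 2) / (c / 2) :=
      (hh.sub contDiff_const).div_const _
    exact (((Real.smoothTransition.contDiff (n := ⊤)).comp h1).mul
      (hh.sub contDiff_const)).add contDiff_const
  · intro x
    simp only
    by_cases hx : c / 2 ≤ h x
    · have := mul_nonneg (Real.smoothTransition.nonneg ((h x - c / 2) / (c / 2)))
        (sub_nonneg.2 hx)
      linarith
    · push Not at hx
      rw [Real.smoothTransition.zero_of_nonpos]
      · simp
      · exact div_nonpos_of_nonpos_of_nonneg (by linarith) (by linarith)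
  · intro x hx
    simp only
    rw [Real.smoothTransition.one_of_one_le]
    · ring
    · rw [le_div_iff₀ (by linarith)]
      linarith [hs x hx]

/-- `g` is the pull-back of the density `f` by a smooth map of the closed ball fixing the sphere. -/
def dmR {n : ℕ} (f g : EuclideanSpace ℝ (Fin n) → ℝ) : Prop :=
  ∃ φ : EuclideanSpace ℝ (Fin n) → EuclideanSpace ℝ (Fin n),
    ContDiff ℝ (⊤ : ℕ∞) φ ∧ Set.BijOn φ (closedBall 0 1) (closedBall 0 1) ∧
    (∀ x, ‖x‖ = 1 → φ x = x) ∧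
    ∀ x ∈ closedBall (0 : EuclideanSpace ℝ (Fin n)) 1,
      g x = f (φ x) * LinearMap.det (fderiv ℝ φ x : EuclideanSpace ℝ (Fin n) →ₗ[ℝ] _)

theorem dmR_refl {n : ℕ} (f : EuclideanSpace ℝ (Fin n) → ℝ) : dmR f f :=
  ⟨id, contDiff_id, Set.bijOn_id _, fun _ _ => rfl, fun x _ => by simp⟩

theorem dmR_trans {n : ℕ} {f g h : EuclideanSpace ℝ (Fin n) → ℝ} (h₁ : dmR f g) (h₂ : dmR g h) :
    dmR f h := by
  obtain ⟨φ, hφ, hb, hid, hd⟩ := h₁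
  obtain ⟨ψ, hψ, hb', hid', hd'⟩ := h₂
  have hne : ((⊤ : ℕ∞) : WithTop ℕ∞) ≠ 0 := by simp
  refine ⟨φ ∘ ψ, hφ.comp hψ, hb.comp hb', fun x hx => ?_, fun x hx => ?_⟩
  · simp [hid' x hx, hid x hx]
  · rw [hd' x hx, hd _ (hb'.mapsTo hx), fderiv_comp x (hφ.differentiable hne _)
      (hψ.differentiable hne _)]
    simp only [Function.comp, ContinuousLinearMap.toLinearMap_comp, LinearMap.det_comp]
    ring

theorem dmR_congr {n : ℕ} {f g f' g' : EuclideanSpace ℝ (Fin n) → ℝ} (h : dmR f g)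
    (hf : ∀ x ∈ closedBall (0 : EuclideanSpace ℝ (Fin n)) 1, f' x = f x)
    (hg : ∀ x ∈ closedBall (0 : EuclideanSpace ℝ (Fin n)) 1, g' x = g x) : dmR f' g' := by
  obtain ⟨φ, hφ, hb, hid, hd⟩ := h
  exact ⟨φ, hφ, hb, hid, fun x hx => by rw [hg x hx, hd x hx, hf _ (hb.mapsTo hx)]⟩

/-- Chords of the unit ball. -/
theorem dm_chord {n : ℕ} (v x : EuclideanSpace ℝ (Fin n)) (hv : ‖v‖ = 1) (hx : ‖x‖ ≤ 1) :
    ∃ τ : ℝ, 0 ≤ τ ∧ ‖x + τ • v‖ = 1 := by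
  have hc : Continuous fun τ : ℝ => ‖x + τ • v‖ := by fun_prop
  have h2 : 1 ≤ ‖x + (2:ℝ) • v‖ := by
    have h1 : ‖(2:ℝ) • v‖ = 2 := by rw [norm_smul, hv]; simp
    have := norm_sub_le (x + (2:ℝ) • v) x
    rw [add_sub_cancel_left] at this
    linarith
  obtain ⟨τ, hτ, h⟩ := intermediate_value_Icc (by norm_num : (0:ℝ) ≤ 2) hc.continuousOn
    (show (1:ℝ) ∈ Set.Icc _ _ from ⟨by simpa using hx, h2⟩)
  exact ⟨τ, hτ.1, h⟩

/-- One step of the construction: changing the density by a derivative in one direction. -/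
theorem dm_step {n : ℕ} (v : EuclideanSpace ℝ (Fin n)) (hv : ‖v‖ = 1)
    (h X : EuclideanSpace ℝ (Fin n) → ℝ) (hh : ContDiff ℝ (⊤ : ℕ∞) h)
    (hX : ContDiff ℝ (⊤ : ℕ∞) X) (hX0 : ∀ x, ‖x‖ = 1 → X x = 0)
    (hpos : ∀ x ∈ closedBall (0 : EuclideanSpace ℝ (Fin n)) 1, 0 < h x)
    (hpos' : ∀ x ∈ closedBall (0 : EuclideanSpace ℝ (Fin n)) 1, 0 < h x + fderiv ℝ X x v) :
    dmR h (fun x => h x + fderiv ℝ X x v) := by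
  have hne : ((⊤ : ℕ∞) : WithTop ℕ∞) ≠ 0 := by simp
  set B := closedBall (0 : EuclideanSpace ℝ (Fin n)) 1 with hB
  have hBc : IsCompact B := isCompact_closedBall _ _
  have hBconv : Convex ℝ B := convex_closedBall _ _
  have hB0 : B.Nonempty := ⟨0, by simp [hB]⟩
  have hmem : ∀ x, x ∈ B ↔ ‖x‖ ≤ 1 := fun x => by simp [hB]
  obtain ⟨x₀, hx₀, hmin⟩ := hBc.exists_isMinOn hB0 hh.continuous.continuousOn
  obtain ⟨k, hk, hkc, hkh⟩ := dm_cutoff h hh B (h x₀) (hpos x₀ hx₀) (fun x hx => hmin hx)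
  have hc : 0 < h x₀ / 2 := half_pos (hpos x₀ hx₀)
  obtain ⟨u, hu, hu0, hue⟩ := dm_core v k X hk hX (h x₀ / 2) hc hkc
  have hupos : ∀ x ∈ B, 0 < 1 + fderiv ℝ u x v := by
    intro x hx
    have h1 := hue x
    have h2 := hpos' x hx
    rw [← hkh x hx, ← h1] at h2
    exact (pos_iff_pos_of_mul_pos h2).1 (hc.trans_le (hkc _))
  -- segment facts
  have hseg : ∀ x (a b s : ℝ), x + a • v ∈ B → x + b • v ∈ B → a ≤ s → s ≤ b →
      x + s • v ∈ B := by
    intro x a b s ha hb has hsb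
    rcases eq_or_lt_of_le (has.trans hsb) with hab | hab
    · have : s = a := le_antisymm (hsb.trans hab.ge) has
      rwa [this]
    · have := hBconv ha hb (a := (b - s) / (b - a)) (b := (s - a) / (b - a))
        (div_nonneg (by linarith) (by linarith)) (div_nonneg (by linarith) (by linarith))
        (by field_simp [(sub_pos.2 hab).ne']; ring)
      convert this using 1
      have hba : b - a ≠ 0 := (sub_pos.2 hab).ne'
      have h1 : (b - s) / (b - a) + (s - a) / (b - a) = 1 := by field_simp; ring
      have h2 : (b - s) / (b - a) * a + (s - a) / (b - a) * b = s := by field_simp; ring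
      rw [smul_add, smul_add, add_add_add_comm, ← add_smul, h1, smul_smul, smul_smul, ← add_smul,
        h2, one_smul]
  have hmc : ∀ x, Continuous fun s : ℝ => s + u (x + s • v) := fun x =>
    continuous_id.add (hu.continuous.comp (by fun_prop))
  have hmd : ∀ x (s : ℝ), HasDerivAt (fun s : ℝ => s + u (x + s • v))
      (1 + fderiv ℝ u (x + s • v) v) s := by
    intro x s
    have hl : HasDerivAt (fun τ : ℝ => x + τ • v) v s := by
      simpa using ((hasDerivAt_id s).smul_const v).const_add x
    exact (hasDerivAt_id s).add
      ((hu.differentiable hne (x + s • v)).hasFDerivAt.comp_hasDerivAt s hl)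
  have hmono : ∀ x (a b : ℝ), x + a • v ∈ B → x + b • v ∈ B →
      StrictMonoOn (fun s : ℝ => s + u (x + s • v)) (Set.Icc a b) := by
    intro x a b ha hb
    refine strictMonoOn_of_deriv_pos (convex_Icc a b) (hmc x).continuousOn ?_
    intro s hs
    rw [(hmd x s).deriv]
    have hs' := interior_subset hs
    exact hupos _ (hseg x a b s ha hb hs'.1 hs'.2)
  have hchord : ∀ x ∈ B, ∃ a b : ℝ, a ≤ 0 ∧ 0 ≤ b ∧ ‖x + a • v‖ = 1 ∧ ‖x + b • v‖ = 1 := by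
    intro x hx
    obtain ⟨b, hb, hb1⟩ := dm_chord v x hv ((hmem x).1 hx)
    obtain ⟨a, ha, ha1⟩ := dm_chord (-v) x (by simpa using hv) ((hmem x).1 hx)
    exact ⟨-a, b, by linarith, hb, by simpa using ha1, hb1⟩
  have hφd : ∀ x, HasFDerivAt (fun x => x + u x • v)
      (ContinuousLinearMap.id ℝ _ + (fderiv ℝ u x).smulRight v) x := fun x =>
    (hasFDerivAt_id x).add ((hu.differentiable hne x).hasFDerivAt.smul_const v)
  have hmaps : Set.MapsTo (fun x => x + u x • v) B B := by
    intro x hx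
    obtain ⟨a, b, ha, hb, ha1, hb1⟩ := hchord x hx
    have hma := (hmem _).2 ha1.le
    have hmb := (hmem _).2 hb1.le
    have hm := (hmono x a b hma hmb).monotoneOn
    have h1 := hm ⟨le_rfl, ha.trans hb⟩ ⟨ha, hb⟩ ha
    have h2 := hm ⟨ha, hb⟩ ⟨ha.trans hb, le_rfl⟩ hb
    simp only [hu0 _ (hX0 _ ha1), hu0 _ (hX0 _ hb1), zero_smul, add_zero, zero_add] at h1 h2
    exact hseg x a b (u x) hma hmb h1 h2
  refine ⟨fun x => x + u x • v, contDiff_id.add (hu.smul contDiff_const), ⟨hmaps, ?_, ?_⟩, ?_, ?_⟩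
  · -- injectivity
    have key : ∀ x ∈ B, ∀ y ∈ B, x + u x • v = y + u y • v → u y < u x → False := by
      intro x hx y hy hxy hlt
      have hy' : y = x + (u x - u y) • v := by
        rw [sub_smul, ← add_sub_assoc, hxy, add_sub_cancel_right]
      have h1 := hmono x 0 (u x - u y) (by simpa using hx) (by rw [← hy']; exact hy)
        ⟨le_rfl, by linarith⟩ ⟨by linarith, le_rfl⟩ (by linarith)
      simp only [← hy', zero_smul, add_zero, zero_add] at h1
      linarith
    intro x hx y hy hxy
    rcases lt_trichotomy (u x) (u y) with hlt | heq | hlt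
    · exact (key y hy x hx hxy.symm hlt).elim
    · simpa [heq] using hxy
    · exact (key x hx y hy hxy hlt).elim
  · -- surjectivity
    intro y hy
    obtain ⟨a, b, ha, hb, ha1, hb1⟩ := hchord y hy
    obtain ⟨s, hs, hs0⟩ := intermediate_value_Icc (ha.trans hb) (hmc y).continuousOn
      (show (0:ℝ) ∈ Set.Icc _ _ by
        rw [hu0 _ (hX0 _ ha1), hu0 _ (hX0 _ hb1)]; exact ⟨by linarith, by linarith⟩)
    refine ⟨y + s • v, hseg y a b s ((hmem _).2 ha1.le) ((hmem _).2 hb1.le) hs.1 hs.2, ?_⟩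
    simp only at hs0 ⊢
    rw [add_assoc, ← add_smul, hs0]
    simp
  · intro x hx
    simp [hu0 x (hX0 x hx)]
  · intro x hx
    have hdet : LinearMap.det ((ContinuousLinearMap.id ℝ (EuclideanSpace ℝ (Fin n)) +
        (fderiv ℝ u x).smulRight v : EuclideanSpace ℝ (Fin n) →L[ℝ] EuclideanSpace ℝ (Fin n)) :
        EuclideanSpace ℝ (Fin n) →ₗ[ℝ] EuclideanSpace ℝ (Fin n)) = 1 + fderiv ℝ u x v := by
      have := LinearMap.transvection.det (R := ℝ)
        (fderiv ℝ u x : EuclideanSpace ℝ (Fin n) →ₗ[ℝ] ℝ) v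
      exact this
    rw [(hφd x).fderiv, hdet, ← hkh _ (hmaps hx)]
    simp only
    rw [← hkh x hx]
    exact (hue x).symm

theorem dmR_integral {n : ℕ} {f g : EuclideanSpace ℝ (Fin n) → ℝ} (h : dmR f g)
    (hf : ∀ x ∈ closedBall (0 : EuclideanSpace ℝ (Fin n)) 1, 0 < f x)
    (hg : ∀ x ∈ closedBall (0 : EuclideanSpace ℝ (Fin n)) 1, 0 < g x) :
    ∫ x in closedBall (0 : EuclideanSpace ℝ (Fin n)) 1, g x =
      ∫ x in closedBall (0 : EuclideanSpace ℝ (Fin n)) 1, f x := by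
  obtain ⟨φ, hφ, hb, hid, hd⟩ := h
  have hne : ((⊤ : ℕ∞) : WithTop ℕ∞) ≠ 0 := by simp
  have h1 := integral_image_eq_integral_abs_det_fderiv_smul volume
    (measurableSet_closedBall (x := (0 : EuclideanSpace ℝ (Fin n))) (ε := 1))
    (f := φ) (f' := fderiv ℝ φ)
    (fun x _ => (hφ.differentiable hne x).hasFDerivAt.hasFDerivWithinAt) hb.injOn f
  rw [hb.image_eq] at h1
  rw [h1]
  refine setIntegral_congr_fun measurableSet_closedBall fun x hx => ?_
  have h2 := hd x hx
  have h3 := hg x hx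
  rw [h2] at h3
  have h4 := (pos_iff_pos_of_mul_pos h3).1 (hf _ (hb.mapsTo hx))
  simp only [smul_eq_mul]
  rw [h2, ContinuousLinearMap.det, abs_of_pos h4, mul_comm]

theorem dm_integral_deriv {n : ℕ} (v : EuclideanSpace ℝ (Fin n)) (hv : ‖v‖ = 1)
    (X : EuclideanSpace ℝ (Fin n) → ℝ)
    (hX : ContDiff ℝ (⊤ : ℕ∞) X) (hX0 : ∀ x, ‖x‖ = 1 → X x = 0) :
    ∫ x in closedBall (0 : EuclideanSpace ℝ (Fin n)) 1, fderiv ℝ X x v = 0 := by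
  have hne : ((⊤ : ℕ∞) : WithTop ℕ∞) ≠ 0 := by simp
  have hBc : IsCompact (closedBall (0 : EuclideanSpace ℝ (Fin n)) 1) := isCompact_closedBall _ _
  have hcont : Continuous fun x => fderiv ℝ X x v :=
    (hX.continuous_fderiv hne).clm_apply continuous_const
  obtain ⟨M, hM⟩ := hBc.exists_bound_of_continuousOn hcont.continuousOn
  have hM0 : 0 ≤ M := (norm_nonneg _).trans (hM 0 (by simp))
  set ε : ℝ := 1 / (M + 1) with hε
  have hεpos : 0 < ε := by positivity
  have hfd : ∀ x, fderiv ℝ (fun x => ε * X x) x v = ε * fderiv ℝ X x v := by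
    intro x
    rw [fderiv_const_mul (hX.differentiable hne x)]
    simp
  have hpos : ∀ x ∈ closedBall (0 : EuclideanSpace ℝ (Fin n)) 1,
      0 < (1:ℝ) + fderiv ℝ (fun x => ε * X x) x v := by
    intro x hx
    rw [hfd]
    have h1 := (abs_le.1 (hM x hx)).1
    have h2 : ε * (M + 1) = 1 := by rw [hε]; field_simp
    nlinarith
  have h1 := dmR_integral (dm_step v hv (fun _ => 1) (fun x => ε * X x) contDiff_const
    (contDiff_const.mul hX) (fun x hx => by simp [hX0 x hx]) (fun x hx => one_pos) hpos)
    (fun x hx => one_pos) hpos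
  have hint : IntegrableOn (fun x => ε * fderiv ℝ X x v)
      (closedBall (0 : EuclideanSpace ℝ (Fin n)) 1) volume :=
    (continuous_const.mul hcont).continuousOn.integrableOn_compact hBc
  have hint1 : IntegrableOn (fun _ => (1:ℝ))
      (closedBall (0 : EuclideanSpace ℝ (Fin n)) 1) volume :=
    continuous_const.continuousOn.integrableOn_compact hBc
  simp only [hfd] at h1
  rw [integral_add hint1 hint, integral_const_mul] at h1
  have h2 : ε * ∫ x in closedBall (0 : EuclideanSpace ℝ (Fin n)) 1, fderiv ℝ X x v = 0 := by
    linarith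
  exact (mul_eq_zero.1 h2).resolve_left hεpos.ne'

theorem dm_norm_e {n : ℕ} (i : Fin n) : ‖(EuclideanSpace.single i (1:ℝ))‖ = 1 := by simp

/-- If `g - f` is a divergence of a field vanishing on the sphere, then `g` is a pull-back
of `f`. -/
theorem dm_of_div {n : ℕ} (f g : EuclideanSpace ℝ (Fin n) → ℝ)
    (hf : ContDiff ℝ (⊤ : ℕ∞) f) (hg : ContDiff ℝ (⊤ : ℕ∞) g)
    (hfpos : ∀ x ∈ closedBall (0 : EuclideanSpace ℝ (Fin n)) 1, 0 < f x)
    (hgpos : ∀ x ∈ closedBall (0 : EuclideanSpace ℝ (Fin n)) 1, 0 < g x)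
    (X : Fin n → EuclideanSpace ℝ (Fin n) → ℝ) (hX : ∀ i, ContDiff ℝ (⊤ : ℕ∞) (X i))
    (hX0 : ∀ i x, ‖x‖ = 1 → X i x = 0)
    (hdiv : ∀ x ∈ closedBall (0 : EuclideanSpace ℝ (Fin n)) 1,
      ∑ i, fderiv ℝ (X i) x (EuclideanSpace.single i 1) = g x - f x) : dmR f g := by
  have hne : ((⊤ : ℕ∞) : WithTop ℕ∞) ≠ 0 := by simp
  set B := closedBall (0 : EuclideanSpace ℝ (Fin n)) 1 with hB
  have hBc : IsCompact B := isCompact_closedBall _ _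
  have hB0 : B.Nonempty := ⟨0, by simp [hB]⟩
  set d : Fin n → EuclideanSpace ℝ (Fin n) → ℝ :=
    fun i x => fderiv ℝ (X i) x (EuclideanSpace.single i 1) with hd
  have hds : ∀ i, ContDiff ℝ (⊤ : ℕ∞) (d i) := fun i =>
    ((hX i).fderiv_right (m := (⊤ : ℕ∞)) (by simp)).clm_apply contDiff_const
  obtain ⟨x₁, hx₁, hm₁⟩ := hBc.exists_isMinOn hB0 hf.continuous.continuousOn
  obtain ⟨x₂, hx₂, hm₂⟩ := hBc.exists_isMinOn hB0 hg.continuous.continuousOn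
  set c := min (f x₁) (g x₂) with hc
  have hcpos : 0 < c := lt_min (hfpos _ hx₁) (hgpos _ hx₂)
  have hcf : ∀ x ∈ B, c ≤ f x := fun x hx => (min_le_left _ _).trans (hm₁ hx)
  have hcg : ∀ x ∈ B, c ≤ g x := fun x hx => (min_le_right _ _).trans (hm₂ hx)
  have hbd : ∀ i, ∃ C, ∀ x ∈ B, ‖d i x‖ ≤ C := fun i =>
    hBc.exists_bound_of_continuousOn (hds i).continuous.continuousOn
  choose C hC using hbd
  have hC0 : ∀ i, 0 ≤ C i := fun i => (norm_nonneg _).trans (hC i x₁ hx₁)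
  set M := ∑ i, C i with hM
  have hM0 : 0 ≤ M := Finset.sum_nonneg fun i _ => hC0 i
  have hsum : ∀ (s : Finset (Fin n)), ∀ x ∈ B, -M ≤ ∑ i ∈ s, d i x := by
    intro s x hx
    have h1 : ∑ i ∈ s, -C i ≤ ∑ i ∈ s, d i x :=
      Finset.sum_le_sum fun i _ => (abs_le.1 (hC i x hx)).1
    have h2 : ∑ i ∈ s, C i ≤ M :=
      Finset.sum_le_sum_of_subset_of_nonneg (Finset.subset_univ s) fun i _ _ => hC0 i
    rw [Finset.sum_neg_distrib] at h1
    linarith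
  obtain ⟨N, hN⟩ := exists_nat_gt (M / c)
  have hNpos : (0:ℝ) < N := lt_of_le_of_lt (by positivity) hN
  set δ : ℝ := 1 / N with hδ
  have hδpos : 0 < δ := by positivity
  have hδM : δ * M < c := by
    rw [div_lt_iff₀ hcpos] at hN
    rw [hδ, one_div, inv_mul_lt_iff₀ hNpos]
    exact hN
  set D : EuclideanSpace ℝ (Fin n) → ℝ := fun x => ∑ i, d i x with hD
  have hDs : ContDiff ℝ (⊤ : ℕ∞) D := ContDiff.sum fun i _ => hds i
  have hbase : ∀ k : ℕ, k ≤ N → ∀ x ∈ B, c ≤ f x + (k * δ) * D x := by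
    intro k hk x hx
    have h1 : D x = g x - f x := hdiv x hx
    have h2 : (k:ℝ) * δ ≤ 1 := by
      rw [hδ, mul_one_div, div_le_one hNpos]; exact_mod_cast hk
    have h3 : 0 ≤ (k:ℝ) * δ := by positivity
    have h4 := hcf x hx
    have h5 := hcg x hx
    rw [h1]
    nlinarith
  have hinner : ∀ k : ℕ, k ≤ N → ∀ s : Finset (Fin n),
      dmR (fun x => f x + (k * δ) * D x)
        (fun x => f x + (k * δ) * D x + δ * ∑ i ∈ s, d i x) := by
    intro k hk s
    have hpos : ∀ (s : Finset (Fin n)), ∀ x ∈ B,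
        0 < f x + (k * δ) * D x + δ * ∑ i ∈ s, d i x := by
      intro s x hx
      have h1 := hbase k hk x hx
      have h2 := mul_le_mul_of_nonneg_left (hsum s x hx) hδpos.le
      linarith
    induction s using Finset.induction_on with
    | empty => simpa using dmR_refl _
    | insert i s his ih =>
      refine dmR_trans ih ?_
      have hfd : ∀ x, fderiv ℝ (fun x => δ * X i x) x (EuclideanSpace.single i 1) =
          δ * d i x := by
        intro x
        rw [fderiv_const_mul ((hX i).differentiable hne x)]
        simp [hd]
      have heq : ∀ x, f x + (k * δ) * D x + δ * ∑ i ∈ insert i s, d i x =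
          (f x + (k * δ) * D x + δ * ∑ i ∈ s, d i x) +
            fderiv ℝ (fun x => δ * X i x) x (EuclideanSpace.single i 1) := by
        intro x
        rw [hfd, Finset.sum_insert his]; ring
      have hst := dm_step (EuclideanSpace.single i 1) (dm_norm_e i)
        (fun x => f x + (k * δ) * D x + δ * ∑ i ∈ s, d i x) (fun x => δ * X i x)
        ((hf.add (contDiff_const.mul hDs)).add
          (contDiff_const.mul (ContDiff.sum fun i _ => hds i)))
        (contDiff_const.mul (hX i)) (fun x hx => by simp [hX0 i x hx]) (hpos s)
        (fun x hx => by
          have := hpos (insert i s) x hx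
          rwa [heq] at this)
      exact dmR_congr hst (fun _ _ => rfl) (fun x _ => heq x)
  have houter : ∀ k : ℕ, k ≤ N → dmR f (fun x => f x + (k * δ) * D x) := by
    intro k
    induction k with
    | zero => intro _; simpa using dmR_refl f
    | succ k ih =>
      intro hk
      refine dmR_trans (ih (by omega)) (dmR_congr (hinner k (by omega) Finset.univ)
        (fun _ _ => rfl) fun x _ => ?_)
      push_cast
      simp only [hD]
      ring
  refine dmR_congr (houter N le_rfl) (fun _ _ => rfl) fun x hx => ?_
  have h1 : D x = g x - f x := hdiv x hx
  rw [h1, hδ]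
  field_simp
  ring

/-- Solving the divergence equation away from the origin by a radial field. -/
theorem dm_radial {n : ℕ} (hn : 1 ≤ n) (w : EuclideanSpace ℝ (Fin n) → ℝ)
    (hw : ContDiff ℝ (⊤ : ℕ∞) w) (ρ : ℝ) (hρ : 0 < ρ) (hρ1 : ρ ≤ 1) :
    ∃ X : Fin n → EuclideanSpace ℝ (Fin n) → ℝ, (∀ i, ContDiff ℝ (⊤ : ℕ∞) (X i)) ∧
      (∀ i x, ‖x‖ = 1 → X i x = 0) ∧
      ∀ x, ρ ≤ ‖x‖ → ∑ i, fderiv ℝ (X i) x (EuclideanSpace.single i 1) = w x := by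
  have hne : ((⊤ : ℕ∞) : WithTop ℕ∞) ≠ 0 := by simp
  obtain ⟨k, hk, hkc, hke⟩ := dm_cutoff (fun x : EuclideanSpace ℝ (Fin n) => ‖x‖ ^ 2)
    (contDiff_norm_sq ℝ) {x | ρ / 2 ≤ ‖x‖} ((ρ / 2) ^ 2) (by positivity)
    (fun x hx => by
      have : ρ / 2 ≤ ‖x‖ := hx
      gcongr)
  have hkpos : ∀ x, 0 < k x := fun x => lt_of_lt_of_le (by positivity) (hkc x)
  set q : EuclideanSpace ℝ (Fin n) → ℝ := fun x => (Real.sqrt (k x))⁻¹ with hq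
  have hqs : ContDiff ℝ (⊤ : ℕ∞) q :=
    (hk.sqrt fun x => (hkpos x).ne').inv fun x => (Real.sqrt_pos.2 (hkpos x)).ne'
  have hqe : ∀ x : EuclideanSpace ℝ (Fin n), ρ / 2 ≤ ‖x‖ → q x = ‖x‖⁻¹ := by
    intro x hx
    simp only [hq]
    rw [hke x hx, Real.sqrt_sq (norm_nonneg x)]
  set a : EuclideanSpace ℝ (Fin n) → ℝ :=
    fun x => ∫ t in (q x)..1, w (t • x) * t ^ (n - 1) with ha
  have has : ContDiff ℝ (⊤ : ℕ∞) a := by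
    refine dm_contDiff_primitive₂ (fun p : EuclideanSpace ℝ (Fin n) × ℝ =>
      w (p.2 • p.1) * p.2 ^ (n - 1)) ?_ q (fun _ => 1) hqs contDiff_const
    exact (hw.comp (contDiff_snd.smul contDiff_fst)).mul (contDiff_snd.pow _)
  have ha1 : ∀ x, ‖x‖ = 1 → a x = 0 := by
    intro x hx
    simp only [ha]
    rw [hqe x (by linarith), hx]
    simp
  have hda : ∀ x, ρ ≤ ‖x‖ → fderiv ℝ a x x = w x - n * a x := by
    intro x hx
    have hx0 : 0 < ‖x‖ := hρ.trans_le hx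
    set F : ℝ → ℝ := fun s => w (s • x) * s ^ (n - 1) with hF
    have hFc : Continuous F := (hw.continuous.comp (by fun_prop)).mul (by fun_prop)
    have hl : HasDerivAt (fun r : ℝ => r • x) x 1 := by
      simpa using (hasDerivAt_id (1:ℝ)).smul_const x
    have had : HasDerivAt (fun r : ℝ => a (r • x)) (fderiv ℝ a x x) 1 := by
      have : HasFDerivAt a (fderiv ℝ a x) ((1:ℝ) • x) := by
        rw [one_smul]; exact (has.differentiable hne x).hasFDerivAt
      exact this.comp_hasDerivAt 1 hl
    have hpow : HasDerivAt (fun r : ℝ => r ^ n) (n : ℝ) 1 := by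
      simpa using hasDerivAt_pow n (1:ℝ)
    have hprod := hpow.mul had
    have hprim : HasDerivAt (fun r : ℝ => ∫ s in (‖x‖⁻¹)..r, F s) (F 1) 1 :=
      intervalIntegral.integral_hasDerivAt_right (hFc.intervalIntegrable _ _)
        (hFc.stronglyMeasurableAtFilter _ _) hFc.continuousAt
    have hev : (fun r : ℝ => r ^ n * a (r • x)) =ᶠ[nhds 1]
        fun r : ℝ => ∫ s in (‖x‖⁻¹)..r, F s := by
      have hnh : Set.Ioi (1/2 : ℝ) ∈ nhds (1:ℝ) := Ioi_mem_nhds (by norm_num)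
      filter_upwards [hnh] with r hr
      have hr' : (1/2 : ℝ) < r := hr
      have hr0 : 0 < r := by linarith
      have hnr : ‖r • x‖ = r * ‖x‖ := by rw [norm_smul, Real.norm_of_nonneg hr0.le]
      have hqr : q (r • x) = (r * ‖x‖)⁻¹ := by
        rw [hqe _ (by rw [hnr]; nlinarith), hnr]
      simp only [ha]
      rw [hqr]
      have h1 := intervalIntegral.mul_integral_comp_mul_right (a := (r * ‖x‖)⁻¹) (b := 1)
        (f := F) r
      have h2 : (r * ‖x‖)⁻¹ * r = ‖x‖⁻¹ := by field_simp
      rw [h2, one_mul] at h1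
      rw [← h1]
      rw [← intervalIntegral.integral_const_mul, ← intervalIntegral.integral_const_mul]
      congr 1
      funext t
      simp only [hF]
      rw [smul_smul]
      obtain ⟨m, rfl⟩ : ∃ m, n = m + 1 := ⟨n - 1, by omega⟩
      simp only [Nat.add_sub_cancel]
      rw [mul_pow, pow_succ]
      ring
    have h5 := (hprod.congr_of_eventuallyEq hev.symm).unique hprim
    simp only [hF, one_smul, one_pow, mul_one, one_mul] at h5
    linarith
  refine ⟨fun i x => a x * x i, fun i => has.mul (by fun_prop), fun i x hx => by
    simp [ha1 x hx], fun x hx => ?_⟩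
  have hpd : ∀ i, fderiv ℝ (fun x : EuclideanSpace ℝ (Fin n) => a x * x i) x
      (EuclideanSpace.single i 1) = a x + x i * fderiv ℝ a x (EuclideanSpace.single i 1) := by
    intro i
    have h1 : HasFDerivAt (fun x : EuclideanSpace ℝ (Fin n) => x i)
        (EuclideanSpace.proj i : EuclideanSpace ℝ (Fin n) →L[ℝ] ℝ) x :=
      (EuclideanSpace.proj i : EuclideanSpace ℝ (Fin n) →L[ℝ] ℝ).hasFDerivAt
    have h2 : HasFDerivAt (fun x : EuclideanSpace ℝ (Fin n) => a x * x i) _ x :=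
      (has.differentiable hne x).hasFDerivAt.mul h1
    rw [h2.fderiv]
    simp
  simp only [hpd]
  rw [Finset.sum_add_distrib]
  have hxs : x = ∑ i, x i • (EuclideanSpace.single i (1:ℝ) : EuclideanSpace ℝ (Fin n)) := by
    have := (EuclideanSpace.basisFun (Fin n) ℝ).sum_repr x
    simpa using this.symm
  have hsum : ∑ i, x i * fderiv ℝ a x (EuclideanSpace.single i 1) = fderiv ℝ a x x := by
    have := congrArg (fderiv ℝ a x) hxs
    rw [map_sum] at this
    rw [this]
    simp
  rw [hsum, hda x hx]
  simp

/-- Vanishing outside a cube. -/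
def dmS {n : ℕ} (ρ : ℝ) (w : EuclideanSpace ℝ (Fin n) → ℝ) : Prop :=
  ∀ x, (∃ j, ρ ≤ |x j|) → w x = 0

/-- Proportionality to `η` in the `j`-th coordinate. -/
def dmQ {n : ℕ} (η : ℝ → ℝ) (j : Fin n) (w : EuclideanSpace ℝ (Fin n) → ℝ) : Prop :=
  ∀ x (t : ℝ), w (x + t • EuclideanSpace.single j 1) * η (x j) = η (x j + t) * w x

theorem dm_eta (ρ : ℝ) (hρ : 0 < ρ) : ∃ η : ℝ → ℝ, ContDiff ℝ (⊤ : ℕ∞) η ∧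
    (∀ t, 0 ≤ η t) ∧ (∀ t, ρ ≤ |t| → η t = 0) ∧ 0 < η 0 ∧ ∫ t in (-1:ℝ)..1, η t = 1 := by
  set b : ℝ → ℝ := fun t => Real.smoothTransition (1 - t ^ 2 / ρ ^ 2) with hb
  have hbs : ContDiff ℝ (⊤ : ℕ∞) b :=
    (Real.smoothTransition.contDiff (n := ⊤)).comp
      (contDiff_const.sub ((contDiff_id.pow 2).div_const _))
  have hb0 : ∀ t, 0 ≤ b t := fun t => Real.smoothTransition.nonneg _
  have hb00 : 0 < b 0 := Real.smoothTransition.pos_of_pos (by simp)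
  have hI : 0 < ∫ t in (-1:ℝ)..1, b t :=
    intervalIntegral.integral_pos (by norm_num) hbs.continuous.continuousOn
      (fun t _ => hb0 t) ⟨0, by norm_num, hb00⟩
  refine ⟨fun t => b t / ∫ t in (-1:ℝ)..1, b t, hbs.div_const _,
    fun t => div_nonneg (hb0 t) hI.le, fun t ht => ?_, div_pos hb00 hI, ?_⟩
  · have : b t = 0 := by
      refine Real.smoothTransition.zero_of_nonpos ?_
      have h1 : ρ ^ 2 ≤ t ^ 2 := by
        rw [← sq_abs t]; gcongr
      have h2 : 1 ≤ t ^ 2 / ρ ^ 2 := by rw [le_div_iff₀ (by positivity)]; linarith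
      linarith
    simp [this]
  · rw [intervalIntegral.integral_div, div_self hI.ne']

theorem dm_cube_step {n : ℕ} (ρ : ℝ) (hρ : 0 < ρ) (hρ1 : ρ ≤ 1) (η : ℝ → ℝ)
    (hη : ContDiff ℝ (⊤ : ℕ∞) η) (hηs : ∀ t, ρ ≤ |t| → η t = 0)
    (hη1 : ∫ t in (-1:ℝ)..1, η t = 1)
    (i : Fin n) (w : EuclideanSpace ℝ (Fin n) → ℝ) (hw : ContDiff ℝ (⊤ : ℕ∞) w)
    (hS : dmS ρ w) :
    ∃ X w' : EuclideanSpace ℝ (Fin n) → ℝ, ContDiff ℝ (⊤ : ℕ∞) X ∧ ContDiff ℝ (⊤ : ℕ∞) w' ∧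
      dmS ρ X ∧ dmS ρ w' ∧ (∀ x, w x = fderiv ℝ X x (EuclideanSpace.single i 1) + w' x) ∧
      (∀ j, j ≠ i → dmQ η j w → dmQ η j w') ∧ dmQ η i w' := by
  have hne : ((⊤ : ℕ∞) : WithTop ℕ∞) ≠ 0 := by simp
  set e : EuclideanSpace ℝ (Fin n) := EuclideanSpace.single i 1 with he
  have hei : e i = 1 := by simp [he]
  have hej : ∀ j, j ≠ i → e j = 0 := fun j hj => by simp [he, hj]
  set P : EuclideanSpace ℝ (Fin n) → ℝ → ℝ := fun x t => w (x + (t - x i) • e) with hP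
  have hPs : ContDiff ℝ (⊤ : ℕ∞) fun p : EuclideanSpace ℝ (Fin n) × ℝ => P p.1 p.2 :=
    hw.comp (by fun_prop)
  have hPc : ∀ x, Continuous (P x) := fun x => hPs.continuous.comp (by fun_prop : Continuous fun t : ℝ => (x, t))
  have hPinv : ∀ x (τ : ℝ), P (x + τ • e) = P x := by
    intro x τ
    funext t
    simp only [hP]
    congr 1
    have : (x + τ • e) i = x i + τ := by simp [hei]
    rw [this]
    module
  have hPz : ∀ x t, ρ ≤ |t| → P x t = 0 := by
    intro x t ht
    refine hS _ ⟨i, ?_⟩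
    simpa [hei] using ht
  have hPz' : ∀ x t j, j ≠ i → ρ ≤ |x j| → P x t = 0 := by
    intro x t j hj ht
    refine hS _ ⟨j, ?_⟩
    simpa [hej j hj] using ht
  set J : EuclideanSpace ℝ (Fin n) → ℝ := fun x => ∫ t in (-1:ℝ)..1, P x t with hJ
  have hJs : ContDiff ℝ (⊤ : ℕ∞) J :=
    dm_contDiff_primitive₂ _ hPs (fun _ => -1) (fun _ => 1) contDiff_const contDiff_const
  have hJinv : ∀ x (τ : ℝ), J (x + τ • e) = J x := fun x τ => by simp only [hJ, hPinv]
  set X : EuclideanSpace ℝ (Fin n) → ℝ :=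
    fun x => ∫ t in (-1:ℝ)..(x i), (P x t - η t * J x) with hXd
  have hXs : ContDiff ℝ (⊤ : ℕ∞) X :=
    dm_contDiff_primitive₂ (fun p : EuclideanSpace ℝ (Fin n) × ℝ =>
      P p.1 p.2 - η p.2 * J p.1) (hPs.sub ((hη.comp contDiff_snd).mul (hJs.comp contDiff_fst)))
      (fun _ => -1) (fun x => x i) contDiff_const (by fun_prop)
  have hintc : ∀ x, Continuous fun t => P x t - η t * J x := fun x =>
    (hPc x).sub (hη.continuous.mul continuous_const)
  have hJz : ∀ x j, j ≠ i → ρ ≤ |x j| → J x = 0 := by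
    intro x j hj h
    simp only [hJ]
    simp [hPz' x _ j hj h]
  refine ⟨X, fun x => η (x i) * J x, hXs, ?_, ?_, ?_, ?_, ?_, ?_⟩
  · exact (hη.comp (by fun_prop)).mul hJs
  · rintro x ⟨j, hj⟩
    by_cases hji : j = i
    · subst hji
      rcases le_abs.1 hj with h | h
      · have h1 : X x = (∫ t in (-1:ℝ)..1, (P x t - η t * J x)) -
            ∫ t in (x j)..1, (P x t - η t * J x) := by
          simp only [hXd]
          rw [eq_sub_iff_add_eq]
          exact intervalIntegral.integral_add_adjacent_intervals
            ((hintc x).intervalIntegrable _ _) ((hintc x).intervalIntegrable _ _)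
        have h2 : ∫ t in (x j)..1, (P x t - η t * J x) = 0 := by
          refine (intervalIntegral.integral_congr (g := fun _ => 0) fun t ht => ?_).trans (by simp)
          have ht1 : ρ ≤ t := (le_min h hρ1).trans ht.1
          have ht2 : ρ ≤ |t| := ht1.trans (le_abs_self t)
          simp [hPz x t ht2, hηs t ht2]
        have hc2 : Continuous fun t : ℝ => η t * J x := hη.continuous.mul continuous_const
        rw [h1, h2, intervalIntegral.integral_sub ((hPc x).intervalIntegrable _ _)
          (hc2.intervalIntegrable _ _),
          intervalIntegral.integral_mul_const, hη1]
        simp [hJ]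
      · simp only [hXd]
        refine (intervalIntegral.integral_congr (g := fun _ => 0) fun t ht => ?_).trans (by simp)
        have ht1 : t ≤ -ρ := ht.2.trans (max_le (by linarith) (by linarith))
        have ht2 : ρ ≤ |t| := (by linarith : ρ ≤ -t).trans (neg_le_abs t)
        simp [hPz x t ht2, hηs t ht2]
    · simp only [hXd]
      simp [hPz' x _ j hji hj, hJz x j hji hj]
  · rintro x ⟨j, hj⟩
    by_cases hji : j = i
    · subst hji
      simp [hηs _ hj]
    · simp [hJz x j hji hj]
  · intro x
    have hl : HasDerivAt (fun τ : ℝ => x + τ • e) e 0 := by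
      simpa using ((hasDerivAt_id (0:ℝ)).smul_const e).const_add x
    have h1 : HasDerivAt (fun τ : ℝ => X (x + τ • e)) (fderiv ℝ X x e) 0 := by
      have : HasFDerivAt X (fderiv ℝ X x) (x + (0:ℝ) • e) := by
        rw [zero_smul, add_zero]; exact (hXs.differentiable hne x).hasFDerivAt
      exact this.comp_hasDerivAt 0 hl
    have h2 : (fun τ : ℝ => X (x + τ • e)) =
        fun τ : ℝ => ∫ t in (-1:ℝ)..(x i + τ), (P x t - η t * J x) := by
      funext τ
      simp only [hXd, hPinv, hJinv]
      congr 1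
      simp [hei]
    have h3 : HasDerivAt (fun s => ∫ t in (-1:ℝ)..s, (P x t - η t * J x))
        (P x (x i + 0) - η (x i + 0) * J x) (x i + 0) :=
      intervalIntegral.integral_hasDerivAt_right ((hintc x).intervalIntegrable _ _)
        ((hintc x).stronglyMeasurableAtFilter _ _) (hintc x).continuousAt
    have h4 : HasDerivAt (fun τ : ℝ => ∫ t in (-1:ℝ)..(x i + τ), (P x t - η t * J x))
        (P x (x i + 0) - η (x i + 0) * J x) 0 :=
      h3.comp_const_add (x i) 0
    rw [h2] at h1
    have h5 := h1.unique h4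
    have h6 : P x (x i) = w x := by simp [hP]
    rw [h5, add_zero, h6]
    ring
  · intro j hj hQ x t
    have hxi : (x + t • (EuclideanSpace.single j 1 : EuclideanSpace ℝ (Fin n))) i = x i := by
      simp [hj.symm]
    have hJ1 : J (x + t • EuclideanSpace.single j 1) * η (x j) = η (x j + t) * J x := by
      simp only [hJ]
      rw [← intervalIntegral.integral_mul_const, ← intervalIntegral.integral_const_mul]
      congr 1
      funext s
      simp only [hP, hxi]
      have := hQ (x + (s - x i) • e) t
      have hxj : (x + (s - x i) • e) j = x j := by simp [hej j hj]
      rw [hxj] at this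
      rw [← this]
      congr 2
      abel
    simp only [hxi]
    rw [mul_assoc, hJ1]
    ring
  · intro x t
    simp only [← he, hJinv]
    have : (x + t • e) i = x i + t := by simp [hei]
    rw [this]
    ring

theorem dm_cube {n : ℕ} (ρ : ℝ) (hρ : 0 < ρ) (hρ1 : ρ ≤ 1) (hρn : n * ρ ^ 2 < 1)
    (w : EuclideanSpace ℝ (Fin n) → ℝ) (hw : ContDiff ℝ (⊤ : ℕ∞) w)
    (hS : dmS ρ w)
    (hint : ∫ x in closedBall (0 : EuclideanSpace ℝ (Fin n)) 1, w x = 0) :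
    ∃ X : Fin n → EuclideanSpace ℝ (Fin n) → ℝ, (∀ i, ContDiff ℝ (⊤ : ℕ∞) (X i)) ∧
      (∀ i x, ‖x‖ = 1 → X i x = 0) ∧
      ∀ x, ∑ i, fderiv ℝ (X i) x (EuclideanSpace.single i 1) = w x := by
  have hne : ((⊤ : ℕ∞) : WithTop ℕ∞) ≠ 0 := by simp
  obtain ⟨η, hη, hη0, hηs, hη00, hη1⟩ := dm_eta ρ hρ
  have hBc : IsCompact (closedBall (0 : EuclideanSpace ℝ (Fin n)) 1) := isCompact_closedBall _ _
  have hsphere : ∀ X : EuclideanSpace ℝ (Fin n) → ℝ, dmS ρ X → ∀ x, ‖x‖ = 1 → X x = 0 := by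
    intro X hX x hx
    refine hX x ?_
    by_contra! hcon
    have h1 : ‖x‖ ^ 2 = ∑ j, ‖x j‖ ^ 2 := EuclideanSpace.norm_sq_eq x
    have h2 : ∑ j, ‖x j‖ ^ 2 ≤ ∑ _j : Fin n, ρ ^ 2 := by
      refine Finset.sum_le_sum fun j _ => ?_
      have := (hcon j).le
      rw [Real.norm_eq_abs]
      gcongr
    simp at h2
    rw [hx] at h1
    simp at h1
    linarith
  have key : ∀ s : Finset (Fin n), ∃ (X : Fin n → EuclideanSpace ℝ (Fin n) → ℝ)
      (w' : EuclideanSpace ℝ (Fin n) → ℝ), (∀ i, ContDiff ℝ (⊤ : ℕ∞) (X i)) ∧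
      (∀ i, dmS ρ (X i)) ∧ ContDiff ℝ (⊤ : ℕ∞) w' ∧ dmS ρ w' ∧ (∀ j ∈ s, dmQ η j w') ∧
      ∀ x, w x = ∑ i ∈ s, fderiv ℝ (X i) x (EuclideanSpace.single i 1) + w' x := by
    intro s
    induction s using Finset.induction_on with
    | empty => exact ⟨fun _ _ => 0, w, fun _ => contDiff_const, fun _ _ _ => rfl, hw, hS,
        by simp, by simp⟩
    | insert i s his ih =>
      obtain ⟨X, w', hX, hXS, hw', hw'S, hQ, heq⟩ := ih
      obtain ⟨Y, w'', hY, hw'', hYS, hw''S, hYe, hYQ, hYi⟩ :=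
        dm_cube_step ρ hρ hρ1 η hη hηs hη1 i w' hw' hw'S
      refine ⟨Function.update X i Y, w'', ?_, ?_, hw'', hw''S, ?_, ?_⟩
      · intro j
        by_cases hj : j = i
        · subst hj; simpa using hY
        · simpa [hj] using hX j
      · intro j
        by_cases hj : j = i
        · subst hj; simpa using hYS
        · simpa [hj] using hXS j
      · intro j hj
        by_cases hji : j = i
        · subst hji; exact hYi
        · exact hYQ j hji (hQ j ((Finset.mem_insert.1 hj).resolve_left hji))
      · intro x
        rw [Finset.sum_insert his, heq x, hYe x]
        have : ∑ j ∈ s, fderiv ℝ (Function.update X i Y j) x (EuclideanSpace.single j 1) =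
            ∑ j ∈ s, fderiv ℝ (X j) x (EuclideanSpace.single j 1) := by
          refine Finset.sum_congr rfl fun j hj => ?_
          have : j ≠ i := fun h => his (h ▸ hj)
          simp [this]
        rw [this]
        simp
        ring
  obtain ⟨X, w', hX, hXS, hw', hw'S, hQ, heq⟩ := key Finset.univ
  refine ⟨X, hX, fun i => hsphere (X i) (hXS i), ?_⟩
  -- the remainder has zero integral
  have hdc : ∀ i, Continuous fun x => fderiv ℝ (X i) x (EuclideanSpace.single i 1) := fun i =>
    ((hX i).continuous_fderiv hne).clm_apply continuous_const
  have hint' : ∫ x in closedBall (0 : EuclideanSpace ℝ (Fin n)) 1, w' x = 0 := by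
    have h1 : ∫ x in closedBall (0 : EuclideanSpace ℝ (Fin n)) 1,
        (∑ i, fderiv ℝ (X i) x (EuclideanSpace.single i 1) + w' x) = 0 := by
      rw [← hint]; congr 1; funext x; exact (heq x).symm
    rw [integral_add, integral_finsetSum] at h1
    · have h2 : ∀ i, ∫ x in closedBall (0 : EuclideanSpace ℝ (Fin n)) 1,
          fderiv ℝ (X i) x (EuclideanSpace.single i 1) = 0 := fun i =>
        dm_integral_deriv _ (dm_norm_e i) (X i) (hX i) (hsphere (X i) (hXS i))
      simpa [h2] using h1
    · exact fun i _ => (hdc i).continuousOn.integrableOn_compact hBc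
    · exact (continuous_finsetSum _ fun i _ => hdc i).continuousOn.integrableOn_compact hBc
    · exact hw'.continuous.continuousOn.integrableOn_compact hBc
  -- the remainder is a multiple of a product of bumps
  have hprod : ∀ (s : Finset (Fin n)) x, w' x * ∏ _j ∈ s, η 0 =
      (∏ j ∈ s, η (x j)) *
        w' (x - ∑ j ∈ s, x j • (EuclideanSpace.single j 1 : EuclideanSpace ℝ (Fin n))) := by
    intro s x
    induction s using Finset.induction_on with
    | empty => simp
    | insert i s his ih =>
      rw [Finset.prod_insert his, Finset.prod_insert his, Finset.sum_insert his]
      have h1 := hQ i (Finset.mem_univ i) (x - ∑ j ∈ s, x j •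
        (EuclideanSpace.single j 1 : EuclideanSpace ℝ (Fin n)) + (-(x i)) •
          (EuclideanSpace.single i 1 : EuclideanSpace ℝ (Fin n))) (x i)
      have hz : (∑ j ∈ s, x j • (EuclideanSpace.single j 1 : EuclideanSpace ℝ (Fin n))) i = 0 := by
        rw [WithLp.ofLp_sum, Finset.sum_apply]
        refine Finset.sum_eq_zero fun j hj => ?_
        have : i ≠ j := fun h => his (h ▸ hj)
        simp [this]
      have h2 : (x - ∑ j ∈ s, x j • (EuclideanSpace.single j 1 : EuclideanSpace ℝ (Fin n)) +
          (-(x i)) • (EuclideanSpace.single i 1 : EuclideanSpace ℝ (Fin n))) i = 0 := by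
        rw [PiLp.add_apply, PiLp.sub_apply, hz]
        simp
      rw [h2, zero_add] at h1
      have h3 : x - ∑ j ∈ s, x j • (EuclideanSpace.single j 1 : EuclideanSpace ℝ (Fin n)) +
          (-(x i)) • (EuclideanSpace.single i 1 : EuclideanSpace ℝ (Fin n)) +
          x i • (EuclideanSpace.single i 1 : EuclideanSpace ℝ (Fin n)) =
          x - ∑ j ∈ s, x j • (EuclideanSpace.single j 1 : EuclideanSpace ℝ (Fin n)) := by
        module
      have h4 : x - ∑ j ∈ s, x j • (EuclideanSpace.single j 1 : EuclideanSpace ℝ (Fin n)) +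
          (-(x i)) • (EuclideanSpace.single i 1 : EuclideanSpace ℝ (Fin n)) =
          x - (x i • (EuclideanSpace.single i 1 : EuclideanSpace ℝ (Fin n)) +
            ∑ j ∈ s, x j • (EuclideanSpace.single j 1 : EuclideanSpace ℝ (Fin n))) := by
        module
      rw [h3, h4] at h1
      calc w' x * (η 0 * ∏ _j ∈ s, η 0) = (w' x * ∏ _j ∈ s, η 0) * η 0 := by ring
        _ = (∏ j ∈ s, η (x j)) * (w' (x - ∑ j ∈ s, x j •
            (EuclideanSpace.single j 1 : EuclideanSpace ℝ (Fin n))) * η 0) := by rw [ih]; ring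
        _ = _ := by rw [h1]; ring
  have hform : ∀ x, w' x * ∏ _j : Fin n, η 0 = (∏ j, η (x j)) * w' 0 := by
    intro x
    have hxs : ∑ i, x i • (EuclideanSpace.single i (1:ℝ) : EuclideanSpace ℝ (Fin n)) = x := by
      have := (EuclideanSpace.basisFun (Fin n) ℝ).sum_repr x
      simpa using this
    have := hprod Finset.univ x
    rw [hxs, sub_self] at this
    exact this
  have hcpos : 0 < ∏ _j : Fin n, η 0 := Finset.prod_pos fun _ _ => hη00
  have hpc : Continuous fun x : EuclideanSpace ℝ (Fin n) => ∏ j, η (x j) :=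
    continuous_finsetProd _ fun j _ => hη.continuous.comp (by fun_prop)
  have hIpos : 0 < ∫ x in closedBall (0 : EuclideanSpace ℝ (Fin n)) 1, ∏ j, η (x j) := by
    rw [setIntegral_pos_iff_support_of_nonneg_ae]
    · have hopen : IsOpen (Function.support fun x : EuclideanSpace ℝ (Fin n) => ∏ j, η (x j)) :=
        hpc.isOpen_support
      have hsub : (Function.support fun x : EuclideanSpace ℝ (Fin n) => ∏ j, η (x j)) ∩ ball 0 1 ⊆
          (Function.support fun x : EuclideanSpace ℝ (Fin n) => ∏ j, η (x j)) ∩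
            closedBall 0 1 := Set.inter_subset_inter_right _ ball_subset_closedBall
      refine lt_of_lt_of_le ?_ (measure_mono hsub)
      refine (hopen.inter isOpen_ball).measure_pos volume ⟨0, ?_, by simp⟩
      simp [hη00.ne']
    · exact Filter.Eventually.of_forall fun x => Finset.prod_nonneg fun j _ => hη0 _
    · exact hpc.continuousOn.integrableOn_compact hBc
  have hw0 : w' 0 = 0 := by
    have h1 : ∫ x in closedBall (0 : EuclideanSpace ℝ (Fin n)) 1, w' x * ∏ _j : Fin n, η 0 =
        ∫ x in closedBall (0 : EuclideanSpace ℝ (Fin n)) 1, (∏ j, η (x j)) * w' 0 := by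
      congr 1; funext x; exact hform x
    rw [integral_mul_const, integral_mul_const, hint', zero_mul] at h1
    exact (mul_eq_zero.1 h1.symm).resolve_left hIpos.ne'
  intro x
  have h1 := hform x
  rw [hw0, mul_zero] at h1
  have h2 := (mul_eq_zero.1 h1).resolve_right hcpos.ne'
  rw [heq x, h2, add_zero]

/-- Dacorogna–Moser: existence of a solution of the parameterization
tracking problem on the unit ball.  For smooth densities `f, g` positive on
the closed unit ball with equal total mass over the open ball `B`, there is
a smooth self-map `φ` of the closed ball, fixing the boundary sphere,
with positive Jacobian determinant on `B`, solving `g = (f∘φ)·det Dφ` on `B`. -/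
theorem dacorogna_moser_unit_ball {n : ℕ} (hn : 1 ≤ n)
    (f g : EuclideanSpace ℝ (Fin n) → ℝ)
    (hf : ContDiff ℝ (⊤ : ℕ∞) f) (hg : ContDiff ℝ (⊤ : ℕ∞) g)
    (hfpos : ∀ x ∈ closedBall (0 : EuclideanSpace ℝ (Fin n)) 1, 0 < f x)
    (hgpos : ∀ x ∈ closedBall (0 : EuclideanSpace ℝ (Fin n)) 1, 0 < g x)
    (hnorm : ∫ x in ball (0 : EuclideanSpace ℝ (Fin n)) 1, f x
      = ∫ x in ball (0 : EuclideanSpace ℝ (Fin n)) 1, g x) :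
    ∃ φ : EuclideanSpace ℝ (Fin n) → EuclideanSpace ℝ (Fin n),
      ContDiffOn ℝ (⊤ : ℕ∞) φ (closedBall 0 1) ∧
      Set.BijOn φ (closedBall 0 1) (closedBall 0 1) ∧
      (∀ x : EuclideanSpace ℝ (Fin n), ‖x‖ = 1 → φ x = x) ∧
      (∀ x ∈ ball (0 : EuclideanSpace ℝ (Fin n)) 1, 0 < (jacMatrix φ x).det) ∧
      (∀ x ∈ ball (0 : EuclideanSpace ℝ (Fin n)) 1,
        g x = f (φ x) * (jacMatrix φ x).det) := by
  have hne : ((⊤ : ℕ∞) : WithTop ℕ∞) ≠ 0 := by simp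
  have hBc : IsCompact (closedBall (0 : EuclideanSpace ℝ (Fin n)) 1) := isCompact_closedBall _ _
  set ρ : ℝ := 1 / (n + 1) with hρd
  have hρ : 0 < ρ := by positivity
  have hn0 : (0:ℝ) ≤ n := Nat.cast_nonneg n
  have hρe : (n + 1) * ρ = 1 := by rw [hρd]; field_simp
  have hρ1 : ρ ≤ 1 := by nlinarith
  have hρn : n * ρ ^ 2 < 1 := by nlinarith
  obtain ⟨X, hX, hX0, hXe⟩ := dm_radial hn (fun x => g x - f x) (hg.sub hf) ρ hρ hρ1
  have hds : ∀ i, ContDiff ℝ (⊤ : ℕ∞) fun x =>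
      fderiv ℝ (X i) x (EuclideanSpace.single i 1) := fun i =>
    ((hX i).fderiv_right (m := (⊤ : ℕ∞)) (by simp)).clm_apply contDiff_const
  have hset : (closedBall (0 : EuclideanSpace ℝ (Fin n)) 1 : Set _) =ᵐ[volume]
      (ball (0 : EuclideanSpace ℝ (Fin n)) 1 : Set _) := by
    haveI : Nonempty (Fin n) := ⟨⟨0, hn⟩⟩
    have h := Measure.addHaar_sphere (volume : Measure (EuclideanSpace ℝ (Fin n))) 0 1
    rw [← ball_union_sphere]
    exact union_ae_eq_left_of_ae_eq_empty (ae_eq_empty.2 h)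
  obtain ⟨Y, hY, hY0, hYe⟩ := dm_cube ρ hρ hρ1 hρn
    (fun x => (g x - f x) - ∑ i, fderiv ℝ (X i) x (EuclideanSpace.single i 1))
    ((hg.sub hf).sub (ContDiff.sum fun i _ => hds i))
    (by
      rintro x ⟨j, hj⟩
      have h1 : |x j| ≤ ‖x‖ := by
        rw [← Real.norm_eq_abs]; exact PiLp.norm_apply_le x j
      simp only
      rw [hXe x (hj.trans h1), sub_self])
    (by
      have hi : ∀ k : EuclideanSpace ℝ (Fin n) → ℝ, Continuous k →
          IntegrableOn k (closedBall (0 : EuclideanSpace ℝ (Fin n)) 1) volume := fun k hk =>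
        hk.continuousOn.integrableOn_compact hBc
      rw [integral_sub, integral_sub, integral_finsetSum, setIntegral_congr_set hset,
        setIntegral_congr_set hset, hnorm, sub_self, zero_sub, neg_eq_zero]
      · exact Finset.sum_eq_zero fun i _ =>
          dm_integral_deriv _ (dm_norm_e i) (X i) (hX i) (hX0 i)
      · exact fun i _ => hi _ (hds i).continuous
      · exact hi _ hg.continuous
      · exact hi _ hf.continuous
      · exact hi _ (hg.continuous.sub hf.continuous)
      · exact hi _ (continuous_finsetSum _ fun i _ => (hds i).continuous))
  obtain ⟨φ, hφ, hb, hid, hd⟩ := dm_of_div f g hf hg hfpos hgpos (fun i x => X i x + Y i x)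
    (fun i => (hX i).add (hY i)) (fun i x hx => by simp [hX0 i x hx, hY0 i x hx])
    (by
      intro x hx
      have h1 : ∀ i, fderiv ℝ (fun x => X i x + Y i x) x (EuclideanSpace.single i 1) =
          fderiv ℝ (X i) x (EuclideanSpace.single i 1) +
            fderiv ℝ (Y i) x (EuclideanSpace.single i 1) := by
        intro i
        rw [fderiv_fun_add ((hX i).differentiable hne x) ((hY i).differentiable hne x)]
        rfl
      simp only [h1]
      rw [Finset.sum_add_distrib, hYe x]
      ring)
  have hdet : ∀ x ∈ ball (0 : EuclideanSpace ℝ (Fin n)) 1,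
      g x = f (φ x) * (jacMatrix φ x).det := by
    intro x hx
    rw [jacMatrix, LinearMap.det_toMatrix]
    exact hd x (ball_subset_closedBall hx)
  refine ⟨φ, hφ.contDiffOn, hb, hid, fun x hx => ?_, hdet⟩
  have hx' := ball_subset_closedBall hx
  have h1 := hgpos x hx'
  rw [hdet x hx] at h1
  exact (pos_iff_pos_of_mul_pos h1).1 (hfpos _ (hb.mapsTo hx'))
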